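/- arXiv:2407.09632 — 2 statements merged into one kernel-verified Lean document; each statement's English description precedes it below -/
import Mathlib

section
/- Let (Ω, ℙ) be a probability space carrying random variables W : Ω → ℝ^k, X : Ω → ℝ and E : Ω → ℝ, let h : ℝ × ℝ^k × ℝ → ℝ be measurable, and set Y′ := h(X, W, E). Let ν be the law of W and let κ be a regular conditional distribution of (X, E) given W such that for ν-almost every w: (a) κ_w is a product measure μ_w ⊗ ρ_w on ℝ × ℝ, and (b) μ_w({x : |x| > v}) > 0 for every v ∈ ℝ. Let F± : ℝ → [0,1) be nondecreasing with lim_{x→∞} F±(x) = 1. For w ∈ ℝ^k define Γ±(w) := lim_{v→∞} ( ∫ F±(|h(x,w,e)|) 1{|x| > v} dκ_w(x,e) ) / μ_w({x : |x| > v}) whenever the limit exists, and Γ±^baseline(w) := ∫ F±(|h(x,w,e)|) dκ_w(x,e). Then: (i) if |h(x, w, e)| → +∞ as |x| → ∞ for every (w, e), then for ν-almost every w the limit Γ±(w) exists and equals 1; (ii) if h does not depend on its first argument, then for ν-almost every w the limit Γ±(w) exists and equals Γ±^baseline(w), and Γ±^baseline(w) < 1. -/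
open MeasureTheory ProbabilityTheory Filter
open scoped Topology

/-- Averages of `g` over `{|x| > v}` converge to the limit of `g` at infinity. -/
theorem tendsto_setIntegral_lt_abs_div {α : Measure ℝ} [IsFiniteMeasure α] {g : ℝ → ℝ} {c : ℝ}
    (hg : Integrable g α) (hα : ∀ v : ℝ, 0 < α {x : ℝ | v < |x|})
    (hlim : Tendsto g (cocompact ℝ) (𝓝 c)) :
    Tendsto (fun v => (∫ x in {x : ℝ | v < |x|}, g x ∂α) / (α {x : ℝ | v < |x|}).toReal)
      atTop (𝓝 c) := by
  rw [Metric.tendsto_nhds]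
  intro ε hε
  have hev := (Metric.tendsto_nhds.1 hlim) (ε / 2) (half_pos hε)
  rw [cocompact_eq_atBot_atTop, ← comap_abs_atTop, eventually_comap, eventually_atTop] at hev
  obtain ⟨v₀, hv₀⟩ := hev
  filter_upwards [eventually_ge_atTop v₀] with v hv
  have hpos : 0 < (α {x : ℝ | v < |x|}).toReal :=
    ENNReal.toReal_pos (hα v).ne' (measure_ne_top _ _)
  have hbound : ‖∫ x in {x : ℝ | v < |x|}, (g x - c) ∂α‖
      ≤ ε / 2 * (α {x : ℝ | v < |x|}).toReal :=
    norm_setIntegral_le_of_norm_le_const (measure_lt_top _ _) fun x hx => by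
      have hlt : dist (g x) c < ε / 2 := hv₀ |x| (hv.trans (le_of_lt hx)) x rfl
      rw [← dist_eq_norm]
      exact hlt.le
  rw [integral_sub hg.integrableOn (integrable_const c), setIntegral_const, smul_eq_mul,
    measureReal_def] at hbound
  rw [dist_eq_norm, div_sub' hpos.ne', norm_div, Real.norm_of_nonneg hpos.le, div_lt_iff₀ hpos]
  exact hbound.trans_lt (mul_lt_mul_of_pos_right (half_lt_self hε) hpos)

/-- If `f x e` tends to `1` as `|x| → ∞` for every `e` and `|f| ≤ 1`, then so does its average
in `e`. -/
theorem tendsto_integral_cocompact_of_norm_le_one {ρ : Measure ℝ} [IsProbabilityMeasure ρ]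
    {f : ℝ → ℝ → ℝ} (hf : Measurable (Function.uncurry f)) (hb : ∀ x e, ‖f x e‖ ≤ 1)
    (hlim : ∀ e, Tendsto (fun x => f x e) (cocompact ℝ) (𝓝 1)) :
    Tendsto (fun x => ∫ e, f x e ∂ρ) (cocompact ℝ) (𝓝 1) := by
  have : (cocompact ℝ).IsCountablyGenerated := by
    rw [cocompact_eq_atBot_atTop, ← comap_abs_atTop]
    infer_instance
  have key := tendsto_integral_filter_of_dominated_convergence (μ := ρ) (l := cocompact ℝ)
    (F := f) (f := fun _ => (1 : ℝ)) (fun _ => 1)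
    (Eventually.of_forall fun x => (hf.comp measurable_prodMk_left).aestronglyMeasurable)
    (Eventually.of_forall fun x => Eventually.of_forall (hb x))
    (integrable_const 1) (Eventually.of_forall hlim)
  simpa using key

theorem integral_lt_one_of_forall_lt_one {β : Type*} [MeasurableSpace β] {P : Measure β}
    [IsProbabilityMeasure P] {f : β → ℝ} (hf : Integrable f P) (hlt : ∀ q, f q < 1) :
    ∫ q, f q ∂P < 1 := by
  have hpos : 0 < ∫ q, (1 - f q) ∂P := by
    rw [integral_pos_iff_support_of_nonneg (fun q => (sub_pos.2 (hlt q)).le)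
      ((integrable_const 1).sub hf)]
    have : Function.support (fun q => 1 - f q) = Set.univ :=
      Set.eq_univ_of_forall fun q => (sub_pos.2 (hlt q)).ne'
    rw [this]
    simp
  rw [integral_sub (integrable_const 1) hf] at hpos
  simpa using hpos

/-- Fubini for the tail averages under a product law: they converge to the limit at infinity of
the partial integral. -/
theorem tendsto_setIntegral_prod_lt_abs_fst_div {P : Measure (ℝ × ℝ)} [IsProbabilityMeasure P]
    (hP : P = (P.map Prod.fst).prod (P.map Prod.snd))
    (hα : ∀ v : ℝ, 0 < P.map Prod.fst {x : ℝ | v < |x|})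
    {f : ℝ × ℝ → ℝ} (hf : Integrable f P) {c : ℝ}
    (hlim : Tendsto (fun x => ∫ e, f (x, e) ∂(P.map Prod.snd)) (cocompact ℝ) (𝓝 c)) :
    Tendsto (fun v => (∫ q in {q : ℝ × ℝ | v < |q.1|}, f q ∂P) /
      (P.map Prod.fst {x : ℝ | v < |x|}).toReal) atTop (𝓝 c) := by
  have : IsProbabilityMeasure (P.map Prod.fst) :=
    Measure.isProbabilityMeasure_map measurable_fst.aemeasurable
  have : IsProbabilityMeasure (P.map Prod.snd) :=
    Measure.isProbabilityMeasure_map measurable_snd.aemeasurable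
  have hf' : Integrable f ((P.map Prod.fst).prod (P.map Prod.snd)) := hP ▸ hf
  refine (tendsto_setIntegral_lt_abs_div hf'.integral_prod_left hα hlim).congr fun v => ?_
  have hset : {q : ℝ × ℝ | v < |q.1|} = {x : ℝ | v < |x|} ×ˢ Set.univ := by
    ext q
    simp
  congr 1
  conv_rhs => rw [hset, hP]
  rw [setIntegral_prod _ hf'.integrableOn, Measure.restrict_univ]

/-- two-tailed analogue of Statement 14: in the structural model
`Y' = h(X, W, E)` with `κ` a regular conditional distribution of `(X, E)` given `W`
which is a.e. a product measure whose first marginal charges `{|x| > v}` for every `v`: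
(i) if `|h(x, w, e)| → ∞` as `|x| → ∞` for all `(w, e)`, then a.e. the two-tailed
causal coefficient `Γ±(w)` exists and equals `1`;
(ii) if `h` does not depend on its first argument, then a.e. `Γ±(w)` exists and equals
the baseline `Γ±^base(w)`, and `Γ±^base(w) < 1`. -/
theorem stmt16
    {Ω : Type*} [MeasurableSpace Ω] (μ : Measure Ω) [IsProbabilityMeasure μ]
    (k : ℕ) (W : Ω → (Fin k → ℝ)) (X E : Ω → ℝ)
    (hW : Measurable W) (hX : Measurable X) (hE : Measurable E)
    (h : ℝ → (Fin k → ℝ) → ℝ → ℝ)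
    (hhmeas : Measurable fun q : ℝ × (Fin k → ℝ) × ℝ => h q.1 q.2.1 q.2.2)
    (Y' : Ω → ℝ) (hY' : ∀ ω, Y' ω = h (X ω) (W ω) (E ω))
    (κ : Kernel (Fin k → ℝ) (ℝ × ℝ)) [IsMarkovKernel κ]
    (hκ : ∀ (C : Set (Fin k → ℝ)) (D : Set (ℝ × ℝ)),
      MeasurableSet C → MeasurableSet D →
      μ {ω | W ω ∈ C ∧ (X ω, E ω) ∈ D} = ∫⁻ w in C, κ w D ∂(Measure.map W μ))
    (hprod : ∀ᵐ w ∂(Measure.map W μ),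
      κ w = ((κ w).map Prod.fst).prod ((κ w).map Prod.snd))
    (hsupp : ∀ᵐ w ∂(Measure.map W μ),
      ∀ v : ℝ, 0 < (κ w).map Prod.fst {x : ℝ | v < |x|})
    (F : ℝ → ℝ) (hF_mono : Monotone F) (hF_nonneg : ∀ x, 0 ≤ F x)
    (hF_lt : ∀ x, F x < 1) (hF_lim : Tendsto F atTop (𝓝 1)) :
    ((∀ w e, Tendsto (fun x => |h x w e|) (cocompact ℝ) atTop) →
      ∀ᵐ w ∂(Measure.map W μ),
        Tendsto (fun v =>
            (∫ q in {q : ℝ × ℝ | v < |q.1|}, F |h q.1 w q.2| ∂(κ w)) /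
              ((κ w).map Prod.fst {x : ℝ | v < |x|}).toReal)
          atTop (𝓝 1))
    ∧ ((∀ x x' w e, h x w e = h x' w e) →
      ∀ᵐ w ∂(Measure.map W μ),
        Tendsto (fun v =>
            (∫ q in {q : ℝ × ℝ | v < |q.1|}, F |h q.1 w q.2| ∂(κ w)) /
              ((κ w).map Prod.fst {x : ℝ | v < |x|}).toReal)
          atTop (𝓝 (∫ q, F |h q.1 w q.2| ∂(κ w))) ∧
        (∫ q, F |h q.1 w q.2| ∂(κ w)) < 1) := by
  have hmeas : ∀ w, Measurable fun q : ℝ × ℝ => F |h q.1 w q.2| := fun w =>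
    hF_mono.measurable.comp (continuous_abs.measurable.comp (hhmeas.comp
      (measurable_fst.prodMk (measurable_const.prodMk measurable_snd))))
  have hbound : ∀ y, ‖F y‖ ≤ 1 := fun y => by
    rw [Real.norm_of_nonneg (hF_nonneg y)]
    exact (hF_lt y).le
  have hint : ∀ w, Integrable (fun q : ℝ × ℝ => F |h q.1 w q.2|) (κ w) := fun w =>
    Integrable.of_bound (hmeas w).aestronglyMeasurable 1 (Eventually.of_forall fun _ => hbound _)
  have hsnd : ∀ w, IsProbabilityMeasure ((κ w).map Prod.snd) := fun w =>
    Measure.isProbabilityMeasure_map measurable_snd.aemeasurable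
  refine ⟨fun hexp => ?_, fun hconst => ?_⟩
  · filter_upwards [hprod, hsupp] with w hw hα
    have := hsnd w
    exact tendsto_setIntegral_prod_lt_abs_fst_div hw hα (hint w)
      (tendsto_integral_cocompact_of_norm_le_one (f := fun x e => F |h x w e|) (hmeas w)
        (fun _ _ => hbound _) fun e => hF_lim.comp (hexp w e))
  · filter_upwards [hprod, hsupp] with w hw hα
    refine ⟨tendsto_setIntegral_prod_lt_abs_fst_div hw hα (hint w) ?_,
      integral_lt_one_of_forall_lt_one (hint w) fun _ => hF_lt _⟩
    have hpartial : ∀ x, ∫ e, F |h x w e| ∂((κ w).map Prod.snd)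
        = ∫ q, F |h q.1 w q.2| ∂(κ w) := fun x => by
      rw [integral_map measurable_snd.aemeasurable
        (f := fun e => F |h x w e|)
        ((hmeas w).comp (measurable_prodMk_left (x := x))).aestronglyMeasurable]
      exact integral_congr_ae (Eventually.of_forall fun q => by
        simp only [hconst x q.1 w q.2])
    simp only [hpartial]
    exact tendsto_const_nhds
end

section
/- Let p ≥ 1 and let (Ω, ℙ) be a probability space carrying random variables W : Ω → ℝ^k, X : Ω → ℝ and V = (V₁,…,V_p) : Ω → ℝ^p. Let ν be the law of W and let κ be a regular conditional distribution of (X, V) given W such that for ν-almost every w the first marginal μ_w of κ_w satisfies μ_w((v,∞)) > 0 for every v ∈ ℝ. Let F : ℝ → [0,1) be nondecreasing with lim_{x→∞} F(x) = 1. Define Γ_p(w) := lim_{v→∞} ( ∫ max_{1≤i≤p} F(uᵢ) 1{x > v} dκ_w(x,u) ) / μ_w((v,∞)) whenever the limit exists, and Γ_p^baseline(w) := ∫ max_{1≤i≤p} F(uᵢ) dκ_w(x,u). Then: (i) Γ_p^baseline(w) < 1 for ν-almost every w, so that if Γ_p(w) = 1 for ν-almost every w then Γ_p(w) ≠ Γ_p^baseline(w)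 for ν-almost every w; and (ii) if for ν-almost every w the measure κ_w is the product of its two marginals (the future values V are conditionally independent of X given W), then for ν-almost every w the limit Γ_p(w) exists and equals Γ_p^baseline(w). -/
open MeasureTheory ProbabilityTheory Filter
open scoped Topology

/-- A measurable function with values in `[0, 1)` has mean less than `1`. -/
theorem integral_lt_one_of_forall_lt_one_s17 {α : Type*} [MeasurableSpace α] {m : Measure α}
    [IsProbabilityMeasure m] {g : α → ℝ} (hg : Measurable g) (hg0 : ∀ a, 0 ≤ g a)
    (hg1 : ∀ a, g a < 1) : ∫ a, g a ∂m < 1 := by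
  have hint : Integrable g m :=
    Integrable.of_bound hg.aestronglyMeasurable 1
      (ae_of_all _ fun a => by rw [Real.norm_eq_abs, abs_of_nonneg (hg0 a)]; exact (hg1 a).le)
  have hpos : 0 < ∫ a, (1 - g a) ∂m := by
    rw [integral_pos_iff_support_of_nonneg (fun a => sub_nonneg.2 (hg1 a).le)
      ((integrable_const 1).sub hint)]
    have : Function.support (fun a => 1 - g a) = Set.univ :=
      Set.eq_univ_of_forall fun a => (sub_pos.2 (hg1 a)).ne'
    rw [this]
    simp
  rw [integral_sub (integrable_const 1) hint] at hpos
  simpa using hpos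

/-- If `m` is the product of its marginals, conditioning on an event of positive probability for
the first coordinate does not change the mean of a function of the second coordinate. -/
theorem setIntegral_div_eq_integral_of_eq_prod {α β : Type*} [MeasurableSpace α]
    [MeasurableSpace β] {m : Measure (α × β)} [IsProbabilityMeasure m]
    (hm : m = (m.map Prod.fst).prod (m.map Prod.snd)) (g : β → ℝ) {s : Set α}
    (hs : 0 < m.map Prod.fst s) :
    (∫ q in {q : α × β | q.1 ∈ s}, g q.2 ∂m) / (m.map Prod.fst s).toReal = ∫ q, g q.2 ∂m := by
  have : IsProbabilityMeasure (m.map Prod.fst) :=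
    Measure.isProbabilityMeasure_map measurable_fst.aemeasurable
  have : IsProbabilityMeasure (m.map Prod.snd) :=
    Measure.isProbabilityMeasure_map measurable_snd.aemeasurable
  have hset : {q : α × β | q.1 ∈ s} = s ×ˢ Set.univ := by ext; simp
  have hne : (m.map Prod.fst s).toReal ≠ 0 :=
    (ENNReal.toReal_pos hs.ne' (measure_ne_top _ _)).ne'
  have hnum : ∫ q in {q : α × β | q.1 ∈ s}, g q.2 ∂m
      = (m.map Prod.fst s).toReal * ∫ b, g b ∂(m.map Prod.snd) := by
    have h := setIntegral_prod_mul (μ := m.map Prod.fst) (ν := m.map Prod.snd)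
      (fun _ : α => (1 : ℝ)) g s Set.univ
    rw [← hm] at h
    simpa [hset, Measure.real] using h
  have hden : ∫ q, g q.2 ∂m = ∫ b, g b ∂(m.map Prod.snd) := by
    have h := integral_prod_mul (μ := m.map Prod.fst) (ν := m.map Prod.snd)
      (fun _ : α => (1 : ℝ)) g
    rw [← hm] at h
    simpa using h
  rw [hnum, hden, mul_div_cancel_left₀ _ hne]

/-- lagged propositions of the paper: with `κ` a regular conditional
distribution of `(X, V)` given `W` (where `V = (Y_{t+1},…,Y_{t+p})` are the future
values) whose first marginal charges every neighbourhood of `+∞`: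
(i) the baseline `Γ_p^base(w) < 1` ν-a.e., so extreme causality at lag `p`
(`Γ_p = 1` a.e.) implies tail causality at lag `p` (`Γ_p ≠ Γ_p^base` a.e.); and
(ii) if a.e. `κ_w` is the product of its marginals (no Sims causality), then a.e. the
limit `Γ_p(w)` exists and equals `Γ_p^base(w)`. -/
theorem stmt17
    {Ω : Type*} [MeasurableSpace Ω] (μ : Measure Ω) [IsProbabilityMeasure μ]
    (p k : ℕ) (hp : 1 ≤ p)
    (W : Ω → (Fin k → ℝ)) (X : Ω → ℝ) (V : Ω → (Fin p → ℝ))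
    (hW : Measurable W) (hX : Measurable X) (hV : Measurable V)
    (κ : Kernel (Fin k → ℝ) (ℝ × (Fin p → ℝ))) [IsMarkovKernel κ]
    (hκ : ∀ (C : Set (Fin k → ℝ)) (D : Set (ℝ × (Fin p → ℝ))),
      MeasurableSet C → MeasurableSet D →
      μ {ω | W ω ∈ C ∧ (X ω, V ω) ∈ D} = ∫⁻ w in C, κ w D ∂(Measure.map W μ))
    (hsupp : ∀ᵐ w ∂(Measure.map W μ),
      ∀ v : ℝ, 0 < (κ w).map Prod.fst (Set.Ioi v))
    (F : ℝ → ℝ) (hF_mono : Monotone F) (hF_nonneg : ∀ x, 0 ≤ F x)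
    (hF_lt : ∀ x, F x < 1) (hF_lim : Tendsto F atTop (𝓝 1)) :
    ((∀ᵐ w ∂(Measure.map W μ), (∫ q, (⨆ i, F (q.2 i)) ∂(κ w)) < 1) ∧
      ((∀ᵐ w ∂(Measure.map W μ),
          Tendsto (fun v =>
              (∫ q in {q : ℝ × (Fin p → ℝ) | v < q.1}, (⨆ i, F (q.2 i)) ∂(κ w)) /
                ((κ w).map Prod.fst (Set.Ioi v)).toReal)
            atTop (𝓝 1)) →
        ∀ᵐ w ∂(Measure.map W μ),
          ¬ Tendsto (fun v =>
              (∫ q in {q : ℝ × (Fin p → ℝ) | v < q.1}, (⨆ i, F (q.2 i)) ∂(κ w)) /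
                ((κ w).map Prod.fst (Set.Ioi v)).toReal)
            atTop (𝓝 (∫ q, (⨆ i, F (q.2 i)) ∂(κ w)))))
    ∧ ((∀ᵐ w ∂(Measure.map W μ),
        κ w = ((κ w).map Prod.fst).prod ((κ w).map Prod.snd)) →
      ∀ᵐ w ∂(Measure.map W μ),
        Tendsto (fun v =>
            (∫ q in {q : ℝ × (Fin p → ℝ) | v < q.1}, (⨆ i, F (q.2 i)) ∂(κ w)) /
              ((κ w).map Prod.fst (Set.Ioi v)).toReal)
          atTop (𝓝 (∫ q, (⨆ i, F (q.2 i)) ∂(κ w)))) := by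
  have : Nonempty (Fin p) := ⟨⟨0, hp⟩⟩
  have hmeas : Measurable fun q : ℝ × (Fin p → ℝ) => ⨆ i, F (q.2 i) :=
    Measurable.iSup fun i => hF_mono.measurable.comp ((measurable_pi_apply i).comp measurable_snd)
  have hnonneg (q : ℝ × (Fin p → ℝ)) : 0 ≤ ⨆ i, F (q.2 i) :=
    Real.iSup_nonneg fun i => hF_nonneg _
  have hlt (q : ℝ × (Fin p → ℝ)) : ⨆ i, F (q.2 i) < 1 := by
    obtain ⟨i, hi⟩ := exists_eq_ciSup_of_finite (f := fun i => F (q.2 i))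
    exact hi ▸ hF_lt _
  have hbase (w : Fin k → ℝ) : (∫ q, (⨆ i, F (q.2 i)) ∂(κ w)) < 1 :=
    integral_lt_one_of_forall_lt_one_s17 hmeas hnonneg hlt
  refine ⟨⟨ae_of_all _ hbase, fun h => ?_⟩, fun h => ?_⟩
  · filter_upwards [h] with w hw hw'
    exact (hbase w).ne (tendsto_nhds_unique hw' hw)
  · filter_upwards [h, hsupp] with w hw hpos
    refine tendsto_const_nhds.congr fun v => ?_
    exact (setIntegral_div_eq_integral_of_eq_prod hw (fun u => ⨆ i, F (u i)) (hpos v)).symm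
end
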